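/- Let n = 3 or n = 4, let u₀ ∈ S^{n−1}, and let K be a centered convex body of revolution in ℝⁿ about the axis u₀ whose radial function ρ_K is C^∞ on S^{n−1}. Then K is the intersection body of some star body: there exists a nonnegative continuous function g on S^{n−1} with ρ_K = Rg. -/

import Mathlib

open MeasureTheory Metric
open scoped RealInnerProductSpace ENNReal

noncomputable section

abbrev E (n : ℕ) := EuclideanSpace ℝ (Fin n)

/-- The radial function of a set: `ρ_K(x) = max {c ≥ 0 : c • x ∈ K}`. -/
def radialFn {n : ℕ} (K : Set (E n)) (x : E n) : ℝ :=
  sSup {c : ℝ | 0 ≤ c ∧ c • x ∈ K}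

/-- A convex body: compact convex set with nonempty interior. -/
def IsConvexBody {n : ℕ} (K : Set (E n)) : Prop :=
  IsCompact K ∧ Convex ℝ K ∧ (interior K).Nonempty

/-- Centered: symmetric about the origin. -/
def IsCentered {n : ℕ} (K : Set (E n)) : Prop :=
  ∀ x, x ∈ K ↔ -x ∈ K

/-- The hyperplane through the origin orthogonal to `u`. -/
def hyperplane {n : ℕ} (u : E n) : Set (E n) := {x | ⟪x, u⟫ = 0}

/-- A star body: compact, star-shaped at the origin (contains the origin), with
continuous radial function on the unit sphere. -/
def IsStarBody {n : ℕ} (L : Set (E n)) : Prop :=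
  IsCompact L ∧ (0 : E n) ∈ L ∧ StarConvex ℝ 0 L ∧
    ContinuousOn (radialFn L) (sphere (0 : E n) 1)

/-- `L` is the intersection body of `M`: `ρ_L(u) = λ_{n-1}(M ∩ u^⊥)` for `u ∈ S^{n-1}`. -/
def IsIntersectionBodyOf {n : ℕ} (L M : Set (E n)) : Prop :=
  ∀ u ∈ sphere (0 : E n) 1,
    radialFn L u = (μH[(n : ℝ) - 1] (M ∩ hyperplane u)).toReal

/-- The spherical Radon transform:
`(Rg)(u) = ∫_{S^{n-1} ∩ u^⊥} g dλ_{n-2}`. -/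
def radon (n : ℕ) (g : E n → ℝ) (u : E n) : ℝ :=
  ∫ v in (sphere (0 : E n) 1 ∩ hyperplane u), g v ∂μH[(n : ℝ) - 2]

/-- A function on the sphere is C^∞ if its 0-homogeneous extension is smooth
away from the origin. -/
def SmoothOnSphere {n : ℕ} (h : E n → ℝ) : Prop :=
  ContDiffOn ℝ (⊤ : ℕ∞) (fun x : E n => h (‖x‖⁻¹ • x)) {(0 : E n)}ᶜ

/-- A body of revolution about the axis `u₀`: invariant under every (linear)
isometry of `ℝⁿ` fixing `u₀`. -/
def IsRevolutionBody {n : ℕ} (u₀ : E n) (K : Set (E n)) : Prop :=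
  ∀ f : E n ≃ₗᵢ[ℝ] E n, f u₀ = u₀ → f '' K = K

/-- A measure on `ℝᵈ` carried by the unit sphere and invariant under linear isometries. -/
structure IsInvariantSphereMeasure {d : ℕ} (μ : Measure (E d)) : Prop where
  norm_eq_one : ∀ᵐ v ∂μ, ‖v‖ = 1
  map_eq : ∀ f : E d ≃ₗᵢ[ℝ] E d, μ.map f = μ

theorem IsInvariantSphereMeasure.integral_comp_inner {d : ℕ} {μ : Measure (E d)}
    (hμ : IsInvariantSphereMeasure μ) (φ : ℝ → ℝ) {w w' : E d} (h : ‖w‖ = ‖w'‖) :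
    ∫ v, φ ⟪v, w⟫ ∂μ = ∫ v, φ ⟪v, w'⟫ ∂μ := by
  let f := (ℝ ∙ (w - w'))ᗮ.reflection
  have hf : f w = w' := Submodule.reflection_sub h
  have hp : MeasurePreserving f μ μ := ⟨f.continuous.measurable, hμ.map_eq f⟩
  rw [← hp.integral_comp f.toHomeomorph.measurableEmbedding (fun v => φ ⟪v, w'⟫)]
  simp only [← hf, LinearIsometryEquiv.inner_map_map]

theorem exists_smul_unit {F : Type*} [NormedAddCommGroup F] [NormedSpace ℝ F] [Nontrivial F]
    (w : F) : ∃ e : F, ‖e‖ = 1 ∧ w = ‖w‖ • e := by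
  by_cases hw : w = 0
  · obtain ⟨e, he⟩ := exists_norm_eq F zero_le_one
    exact ⟨e, he, by simp [hw]⟩
  · refine ⟨‖w‖⁻¹ • w, by simp [norm_smul, hw], ?_⟩
    rw [smul_smul, mul_inv_cancel₀ (by simpa using hw), one_smul]

theorem IsInvariantSphereMeasure.integral_inner_pow {d : ℕ} {μ : Measure (E d)}
    (hμ : IsInvariantSphereMeasure μ) (i : Fin d) (w : E d) (k : ℕ) :
    ∫ v, ⟪v, w⟫ ^ k ∂μ = ‖w‖ ^ k * ∫ v, (v i) ^ k ∂μ := by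
  rw [hμ.integral_comp_inner (fun x => x ^ k)
    (w' := ‖w‖ • EuclideanSpace.single i (1 : ℝ)) (by simp [norm_smul]), ← integral_const_mul]
  simp [inner_smul_right, mul_pow, EuclideanSpace.inner_single_right]

theorem IsInvariantSphereMeasure.integrable {d : ℕ} {μ : Measure (E d)} [IsFiniteMeasure μ]
    (hμ : IsInvariantSphereMeasure μ) {φ : E d → ℝ} (hφ : Continuous φ) : Integrable φ μ := by
  obtain ⟨C, hC⟩ := (isCompact_sphere (0 : E d) 1).exists_bound_of_continuousOn hφ.continuousOn
  refine Integrable.of_bound hφ.aestronglyMeasurable C ?_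
  filter_upwards [hμ.norm_eq_one] with v hv
  exact hC v (by simpa using hv)

theorem IsInvariantSphereMeasure.integral_pow_mul_sq {d : ℕ} {μ : Measure (E d)}
    [IsFiniteMeasure μ] (hμ : IsInvariantSphereMeasure μ) {i j : Fin d} (hij : i ≠ j) (k : ℕ) :
    (2 * k + 1) * ∫ v, (v i) ^ (2 * k) * (v j) ^ 2 ∂μ = ∫ v, (v i) ^ (2 * (k + 1)) ∂μ := by
  classical
  set m := ∫ v, (v i) ^ (2 * (k + 1)) ∂μ with hm
  let P : Polynomial ℝ := ∑ l ∈ Finset.range (2 * (k + 1) + 1),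
    Polynomial.monomial l
      ((2 * (k + 1)).choose l * ∫ v, (v j) ^ l * (v i) ^ (2 * (k + 1) - l) ∂μ)
  let Q : Polynomial ℝ := Polynomial.expand ℝ 2 ((1 + Polynomial.X) ^ (k + 1) * Polynomial.C m)
  have hPQ : P = Q := by
    refine Polynomial.funext fun t => ?_
    have h := hμ.integral_inner_pow i
      (EuclideanSpace.single i (1 : ℝ) + t • EuclideanSpace.single j (1 : ℝ)) (2 * (k + 1))
    have hn : ‖EuclideanSpace.single i (1 : ℝ) + t • EuclideanSpace.single j (1 : ℝ)‖ ^ 2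
        = 1 + t ^ 2 := by
      rw [norm_add_sq_real]
      simp [norm_smul, inner_smul_right, EuclideanSpace.inner_single_right, hij]
    rw [pow_mul, hn, ← hm] at h
    have hQ : Q.eval t = (1 + t ^ 2) ^ (k + 1) * m := by simp [Q]
    rw [hQ, ← h, Polynomial.eval_finsetSum]
    simp only [Polynomial.eval_monomial, inner_add_right, inner_smul_right,
      EuclideanSpace.inner_single_right, conj_trivial, one_mul]
    simp_rw [add_comm (_ : ℝ) (t * _), add_pow]
    rw [integral_finsetSum _ fun l _ => hμ.integrable (by fun_prop)]
    refine Finset.sum_congr rfl fun l _ => ?_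
    rw [mul_right_comm, ← integral_const_mul]
    congr 1; ext v; ring
  have hc := congrArg (fun p => Polynomial.coeff p 2) hPQ
  have hQ2 : Q.coeff 2 = (k + 1) * m := by
    have : Q.coeff (1 * 2) = _ := Polynomial.coeff_expand_mul two_pos _ 1
    rw [one_mul] at this
    rw [this, Polynomial.coeff_mul_C, Polynomial.coeff_one_add_X_pow]
    simp
  simp only [hQ2, P, Polynomial.finsetSum_coeff, Polynomial.coeff_monomial] at hc
  rw [Finset.sum_ite_eq', if_pos (by simp), show 2 * (k + 1) - 2 = 2 * k by lia,
    Nat.cast_choose_two] at hc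
  have hk : (k + 1 : ℝ) ≠ 0 := by positivity
  apply mul_left_cancel₀ hk
  rw [← hc]
  simp_rw [mul_comm ((_ : ℝ) ^ (2 * k))]
  push_cast
  ring

theorem IsInvariantSphereMeasure.moment_succ {d : ℕ} {μ : Measure (E d)}
    [IsFiniteMeasure μ] (hμ : IsInvariantSphereMeasure μ) (i : Fin d) (k : ℕ) :
    (2 * k + 1) * ∫ v, (v i) ^ (2 * k) ∂μ = (2 * k + d) * ∫ v, (v i) ^ (2 * (k + 1)) ∂μ := by
  classical
  have h1 : ∫ v, (v i) ^ (2 * k) ∂μ = ∑ j, ∫ v, (v i) ^ (2 * k) * (v j) ^ 2 ∂μ := by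
    rw [← integral_finsetSum _ fun j _ => hμ.integrable (by fun_prop)]
    refine integral_congr_ae ?_
    filter_upwards [hμ.norm_eq_one] with v hv
    have : ∑ j, (v j) ^ 2 = 1 := by rw [← EuclideanSpace.real_norm_sq_eq, hv, one_pow]
    rw [← Finset.mul_sum, this, mul_one]
  have h2 : ∀ j ∈ Finset.univ.erase i, (2 * k + 1) * ∫ v, (v i) ^ (2 * k) * (v j) ^ 2 ∂μ
      = ∫ v, (v i) ^ (2 * (k + 1)) ∂μ :=
    fun j hj => hμ.integral_pow_mul_sq (Finset.ne_of_mem_erase hj).symm k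
  have h3 : ∫ v, (v i) ^ (2 * k) * (v i) ^ 2 ∂μ = ∫ v, (v i) ^ (2 * (k + 1)) ∂μ := by
    simp_rw [← pow_add]; rfl
  rw [h1, ← Finset.add_sum_erase _ _ (Finset.mem_univ i), mul_add, Finset.mul_sum,
    Finset.sum_congr rfl h2, h3, Finset.sum_const, Finset.card_erase_of_mem (Finset.mem_univ i),
    Finset.card_univ, Fintype.card_fin, nsmul_eq_mul, Nat.cast_sub (Nat.one_le_of_lt i.isLt)]
  push_cast
  ring

theorem integrable_comp_of_mem_Icc {X : Type*} [MeasurableSpace X] {μ : Measure X}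
    [IsFiniteMeasure μ] {p : X → ℝ} (hp : Measurable p) (hpμ : ∀ᵐ x ∂μ, p x ∈ Set.Icc (0 : ℝ) 1)
    {h : ℝ → ℝ} (hh : Continuous h) : Integrable (fun x => h (p x)) μ := by
  obtain ⟨C, hC⟩ := (isCompact_Icc (a := (0 : ℝ)) (b := 1)).exists_bound_of_continuousOn
    hh.continuousOn
  refine Integrable.of_bound (hh.measurable.comp hp).aestronglyMeasurable C ?_
  filter_upwards [hpμ] with x hx using hC _ hx

/-- Integrals of continuous functions of `[0, 1]`-valued variables are determined by moments. -/
theorem integral_comp_eq_of_moments_eq {X Y : Type*} [MeasurableSpace X] [MeasurableSpace Y]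
    {μ : Measure X} {ν : Measure Y} [IsFiniteMeasure μ] [IsFiniteMeasure ν]
    {p : X → ℝ} {q : Y → ℝ} (hp : Measurable p) (hq : Measurable q)
    (hpμ : ∀ᵐ x ∂μ, p x ∈ Set.Icc (0 : ℝ) 1) (hqν : ∀ᵐ y ∂ν, q y ∈ Set.Icc (0 : ℝ) 1)
    (hmom : ∀ k : ℕ, ∫ x, p x ^ k ∂μ = ∫ y, q y ^ k ∂ν) {h : ℝ → ℝ} (hh : Continuous h) :
    ∫ x, h (p x) ∂μ = ∫ y, h (q y) ∂ν := by
  have hpoly : ∀ P : Polynomial ℝ, ∫ x, P.eval (p x) ∂μ = ∫ y, P.eval (q y) ∂ν := by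
    intro P
    simp_rw [Polynomial.eval_eq_sum_range]
    rw [integral_finsetSum _ fun k _ =>
        integrable_comp_of_mem_Icc hp hpμ (h := fun z => P.coeff k * z ^ k) (by fun_prop),
      integral_finsetSum _ fun k _ =>
        integrable_comp_of_mem_Icc hq hqν (h := fun z => P.coeff k * z ^ k) (by fun_prop)]
    simp_rw [integral_const_mul, hmom]
  have hclose : ∀ ε : ℝ, 0 < ε → |∫ x, h (p x) ∂μ - ∫ y, h (q y) ∂ν|
      ≤ ε * (μ.real Set.univ + ν.real Set.univ) := by
    intro ε hε
    obtain ⟨P, hP⟩ := exists_polynomial_near_of_continuousOn 0 1 h hh.continuousOn ε hε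
    have h1 : ‖∫ x, (P.eval (p x) - h (p x)) ∂μ‖ ≤ ε * μ.real Set.univ :=
      norm_integral_le_of_norm_le_const (by filter_upwards [hpμ] with x hx using (hP _ hx).le)
    have h2 : ‖∫ y, (P.eval (q y) - h (q y)) ∂ν‖ ≤ ε * ν.real Set.univ :=
      norm_integral_le_of_norm_le_const (by filter_upwards [hqν] with y hy using (hP _ hy).le)
    rw [integral_sub (integrable_comp_of_mem_Icc hp hpμ P.continuous)
      (integrable_comp_of_mem_Icc hp hpμ hh), Real.norm_eq_abs, abs_le] at h1
    rw [integral_sub (integrable_comp_of_mem_Icc hq hqν P.continuous)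
      (integrable_comp_of_mem_Icc hq hqν hh), ← hpoly, Real.norm_eq_abs, abs_le] at h2
    rw [abs_le]
    constructor <;> linarith [h1.1, h1.2, h2.1, h2.2]
  by_contra hne
  set D := |∫ x, h (p x) ∂μ - ∫ y, h (q y) ∂ν|
  have hD : 0 < D := abs_pos.2 (sub_ne_zero.2 hne)
  set T := μ.real Set.univ + ν.real Set.univ
  have hT : 0 ≤ T := by positivity
  have := hclose (D / (2 * (T + 1))) (by positivity)
  rw [div_mul_eq_mul_div, le_div_iff₀ (by positivity)] at this
  nlinarith

/-- A smoothing measure whose moments turn the moments of the unit sphere into those of the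
square of a uniform variable. -/
theorem exists_smoothing_measure {d : ℕ} (hd : d = 2 ∨ d = 3) :
    ∃ κ : Measure ℝ, IsFiniteMeasure κ ∧ (∀ᵐ y ∂κ, y ∈ Set.Icc (0 : ℝ) 1) ∧
      κ.real Set.univ = 1 ∧
      ∀ k : ℕ, (2 * k + 3) * ∫ y, y ^ (k + 1) ∂κ = (2 * k + d) * ∫ y, y ^ k ∂κ := by
  rcases hd with rfl | rfl
  · let ρ : Measure ℝ := (volume.restrict (Set.Ioc 0 (Real.pi / 2))).withDensity
      fun β => ENNReal.ofReal (Real.sin β)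
    have hval : ∀ f : ℝ → ℝ, ∫ β, f β ∂ρ = ∫ β in (0 : ℝ)..(Real.pi / 2), Real.sin β * f β := by
      intro f
      rw [integral_withDensity_eq_integral_toReal_smul (by fun_prop) (by simp),
        intervalIntegral.integral_of_le (by positivity)]
      refine setIntegral_congr_fun measurableSet_Ioc fun β hβ => ?_
      have : 0 ≤ Real.sin β :=
        Real.sin_nonneg_of_nonneg_of_le_pi hβ.1.le (by linarith [hβ.2, Real.pi_pos])
      simp [this]
    have hfin : IsFiniteMeasure ρ := by
      refine isFiniteMeasure_withDensity_ofReal ?_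
      exact ((Real.continuous_sin.intervalIntegrable 0 (Real.pi / 2)).1).2
    have hsin : Measurable fun β : ℝ => Real.sin β ^ 2 := by fun_prop
    have hmap : ∀ k : ℕ, ∫ y, y ^ k ∂(ρ.map fun β => Real.sin β ^ 2)
        = ∫ β in (0 : ℝ)..(Real.pi / 2), Real.sin β ^ (2 * k + 1) := by
      intro k
      rw [integral_map hsin.aemeasurable (by fun_prop), hval]
      congr 1; ext β; ring
    refine ⟨ρ.map fun β => Real.sin β ^ 2, inferInstance, ?_, ?_, fun k => ?_⟩
    · refine (ae_map_iff hsin.aemeasurable measurableSet_Icc).2 ?_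
      exact ae_of_all _ fun β => ⟨by positivity, Real.sin_sq_le_one β⟩
    · have := hmap 0
      simpa using this
    · rw [hmap, hmap, show 2 * (k + 1) + 1 = (2 * k + 1) + 2 by ring, integral_sin_pow]
      simp
      field_simp
      ring
  · exact ⟨Measure.dirac 1, inferInstance, by simp [ae_dirac_eq], by simp, fun k => by simp⟩

theorem IsInvariantSphereMeasure.integral_smoothing {d : ℕ} {μ : Measure (E d)}
    [IsFiniteMeasure μ] (hμ : IsInvariantSphereMeasure μ) (i : Fin d)
    {κ : Measure ℝ} [IsFiniteMeasure κ] (hκ : ∀ᵐ y ∂κ, y ∈ Set.Icc (0 : ℝ) 1)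
    (hκ1 : κ.real Set.univ = 1)
    (hmom : ∀ k : ℕ, (2 * k + 3) * ∫ y, y ^ (k + 1) ∂κ = (2 * k + d) * ∫ y, y ^ k ∂κ)
    {h : ℝ → ℝ} (hh : Continuous h) (w : E d) :
    ∫ v, (∫ y, h (⟪v, w⟫ ^ 2 * y) ∂κ) ∂μ
      = μ.real Set.univ * ∫ t in (0 : ℝ)..1, h (‖w‖ ^ 2 * t ^ 2) := by
  have : Nontrivial (E d) := ⟨EuclideanSpace.single i 1, 0, by simp⟩
  obtain ⟨e, he, hwe⟩ := exists_smul_unit w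
  have hle : ∀ᵐ v ∂μ, ⟪v, e⟫ ^ 2 ∈ Set.Icc (0 : ℝ) 1 := by
    filter_upwards [hμ.norm_eq_one] with v hv
    refine ⟨sq_nonneg _, (sq_le_one_iff_abs_le_one _).2 ?_⟩
    simpa [hv, he] using abs_real_inner_le_norm v e
  have hp : ∀ᵐ x ∂μ.prod κ, ⟪x.1, e⟫ ^ 2 * x.2 ∈ Set.Icc (0 : ℝ) 1 := by
    filter_upwards [Measure.quasiMeasurePreserving_fst.ae hle,
      Measure.quasiMeasurePreserving_snd.ae hκ] with x h1 h2
    exact ⟨mul_nonneg h1.1 h2.1, mul_le_one₀ h1.2 h2.1 h2.2⟩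
  have hq : ∀ᵐ x ∂μ.prod (volume.restrict (Set.Ioc (0 : ℝ) 1)),
      (x.2 : ℝ) ^ 2 ∈ Set.Icc (0 : ℝ) 1 := by
    have h0 : ∀ᵐ t ∂volume.restrict (Set.Ioc (0 : ℝ) 1), t ∈ Set.Ioc (0 : ℝ) 1 :=
      ae_restrict_mem measurableSet_Ioc
    filter_upwards [Measure.quasiMeasurePreserving_snd.ae h0] with x hx
    exact ⟨by positivity, pow_le_one₀ hx.1.le hx.2⟩
  have hpm : Measurable fun x : E d × ℝ => ⟪x.1, e⟫ ^ 2 * x.2 := by fun_prop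
  have hqm : Measurable fun x : E d × ℝ => x.2 ^ 2 := by fun_prop
  have hprod : ∀ k : ℕ, (∫ v, ⟪v, e⟫ ^ (2 * k) ∂μ) * ∫ y, y ^ k ∂κ
      = μ.real Set.univ / (2 * k + 1) := by
    intro k
    induction k with
    | zero => simp [hκ1]
    | succ k ih =>
      have h1 := hμ.moment_succ i k
      have h2 := hmom k
      rw [hμ.integral_inner_pow i, he, one_pow, one_mul] at ih ⊢
      have hd : (2 * k + d : ℝ) ≠ 0 := by
        have : 0 < d := i.pos
        positivity
      rw [eq_div_iff (by positivity)] at ih ⊢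
      apply mul_left_cancel₀ hd
      rw [← ih]
      push_cast
      linear_combination (-(2 * k + 3) * ∫ y, y ^ (k + 1) ∂κ) * h1
        + ((2 * k + 1) * ∫ v, (v i) ^ (2 * k) ∂μ) * h2
  have key := integral_comp_eq_of_moments_eq hpm hqm hp hq (fun k => ?_)
    (h := fun z => h (‖w‖ ^ 2 * z)) (by fun_prop)
  · rw [integral_prod _ (integrable_comp_of_mem_Icc hpm hp (h := fun z => h (‖w‖ ^ 2 * z))
      (by fun_prop)), integral_fun_snd (fun t : ℝ => h (‖w‖ ^ 2 * t ^ 2)), smul_eq_mul,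
      ← intervalIntegral.integral_of_le zero_le_one] at key
    rw [← key]
    refine integral_congr_ae (ae_of_all _ fun v => integral_congr_ae (ae_of_all _ fun y => ?_))
    have : ⟪v, w⟫ = ‖w‖ * ⟪v, e⟫ := by
      conv_lhs => rw [hwe, inner_smul_right]
    simp only [this]
    congr 1; ring
  · simp_rw [mul_pow, ← pow_mul]
    rw [integral_prod_mul (fun v : E d => ⟪v, e⟫ ^ (2 * k)) (fun y : ℝ => y ^ k), hprod,
      integral_fun_snd (fun t : ℝ => t ^ (2 * k)), ← intervalIntegral.integral_of_le zero_le_one,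
      integral_pow]
    simp [div_eq_mul_inv]

theorem continuous_integral_mul {κ : Measure ℝ} [IsFiniteMeasure κ]
    (hκ : ∀ᵐ y ∂κ, y ∈ Set.Icc (0 : ℝ) 1) {h : ℝ → ℝ} (hh : Continuous h) :
    Continuous fun z => ∫ y, h (z * y) ∂κ := by
  refine continuous_iff_continuousAt.2 fun z₀ => ?_
  obtain ⟨C, hC⟩ := (isCompact_Icc (a := -(|z₀| + 1)) (b := |z₀| + 1)).exists_bound_of_continuousOn
    hh.continuousOn
  refine continuousAt_of_dominated (bound := fun _ => C)
    (.of_forall fun z => by fun_prop) ?_ (integrable_const C)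
    (ae_of_all _ fun y => by fun_prop)
  filter_upwards [Metric.ball_mem_nhds z₀ one_pos] with z hz
  filter_upwards [hκ] with y hy
  refine hC _ (abs_le.1 ?_)
  have h1 : |z| ≤ |z₀| + 1 := by
    have := abs_sub_abs_le_abs_sub z z₀
    rw [Metric.mem_ball, Real.dist_eq] at hz
    linarith
  rw [abs_mul, abs_of_nonneg hy.1]
  exact (mul_le_of_le_one_right (abs_nonneg z) hy.2).trans h1

theorem IsConvexBody.zero_mem {n : ℕ} {K : Set (E n)} (hK : IsConvexBody K) (hc : IsCentered K) :
    (0 : E n) ∈ K := by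
  obtain ⟨x, hx⟩ := hK.2.2
  have hx := interior_subset hx
  have h : (1 / 2 : ℝ) • x + (1 / 2 : ℝ) • -x ∈ K :=
    hK.2.1 hx ((hc x).1 hx) (by norm_num) (by norm_num) (by norm_num)
  simpa using h

theorem bddAbove_radialFn {n : ℕ} {K : Set (E n)} (hK : IsCompact K) {u : E n} (hu : ‖u‖ = 1) :
    BddAbove {c : ℝ | 0 ≤ c ∧ c • u ∈ K} := by
  obtain ⟨R, hR⟩ := hK.isBounded.exists_norm_le
  refine ⟨R, fun c hc => ?_⟩
  simpa [norm_smul, hu, abs_of_nonneg hc.1] using hR _ hc.2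

theorem le_radialFn {n : ℕ} {K : Set (E n)} (hK : IsCompact K) {u : E n} (hu : ‖u‖ = 1)
    {c : ℝ} (hc : 0 ≤ c) (h : c • u ∈ K) : c ≤ radialFn K u :=
  le_csSup (bddAbove_radialFn hK hu) ⟨hc, h⟩

theorem radialFn_mem {n : ℕ} {K : Set (E n)} (hK : IsCompact K) (h0 : (0 : E n) ∈ K) {u : E n}
    (hu : ‖u‖ = 1) : 0 ≤ radialFn K u ∧ radialFn K u • u ∈ K := by
  have hcl : IsClosed {c : ℝ | 0 ≤ c ∧ c • u ∈ K} :=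
    isClosed_Ici.inter (hK.isClosed.preimage (by fun_prop : Continuous fun c : ℝ => c • u))
  exact hcl.csSup_mem ⟨0, le_rfl, by simpa using h0⟩ (bddAbove_radialFn hK hu)

theorem radialFn_neg {n : ℕ} {K : Set (E n)} (hc : IsCentered K) (u : E n) :
    radialFn K (-u) = radialFn K u := by
  unfold radialFn
  congr 1; ext c
  simp [hc (c • u)]

theorem IsRevolutionBody.mem_iff {n : ℕ} {u₀ : E n} {K : Set (E n)} (h : IsRevolutionBody u₀ K)
    {f : E n ≃ₗᵢ[ℝ] E n} (hf : f u₀ = u₀) (x : E n) : f x ∈ K ↔ x ∈ K := by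
  conv_lhs => rw [← h f hf]
  simp

theorem IsRevolutionBody.radialFn_eq {n : ℕ} {u₀ : E n} {K : Set (E n)}
    (h : IsRevolutionBody u₀ K) {u u' : E n} (hn : ‖u‖ = ‖u'‖) (hi : ⟪u, u₀⟫ = ⟪u', u₀⟫) :
    radialFn K u = radialFn K u' := by
  let f := (ℝ ∙ (u - u'))ᗮ.reflection
  have hf : f u₀ = u₀ := by
    refine Submodule.reflection_mem_subspace_eq_self ?_
    rw [Submodule.mem_orthogonal_singleton_iff_inner_right, inner_sub_left, hi, sub_self]
  have hfu : f u = u' := Submodule.reflection_sub hn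
  unfold radialFn
  congr 1; ext c
  change _ ∧ c • u ∈ K ↔ _ ∧ c • u' ∈ K
  rw [← hfu, ← map_smul, h.mem_iff hf]

/-- The point at angle `θ` from `a` on the unit circle in the plane of `a` and `b`. -/
def circlePoint {n : ℕ} (a b : E n) (θ : ℝ) : E n := Real.cos θ • a + Real.sin θ • b

theorem norm_circlePoint {n : ℕ} {a b : E n} (ha : ‖a‖ = 1) (hb : ‖b‖ = 1) (hab : ⟪a, b⟫ = 0)
    (θ : ℝ) : ‖circlePoint a b θ‖ = 1 := by
  have : ‖circlePoint a b θ‖ ^ 2 = 1 := by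
    rw [circlePoint, norm_add_sq_real]
    simp [norm_smul, inner_smul_left, inner_smul_right, ha, hb, hab]
  exact (pow_eq_one_iff_of_nonneg (norm_nonneg _) two_ne_zero).1 this

theorem inner_circlePoint {n : ℕ} {a b : E n} (ha : ‖a‖ = 1) (hab : ⟪a, b⟫ = 0) (θ : ℝ) :
    ⟪circlePoint a b θ, a⟫ = Real.cos θ := by
  simp [circlePoint, inner_add_left, inner_smul_left, real_inner_comm, hab, ha]

theorem contDiff_radialFn_circlePoint {n : ℕ} {K : Set (E n)} (hsm : SmoothOnSphere (radialFn K))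
    {a b : E n} (ha : ‖a‖ = 1) (hb : ‖b‖ = 1) (hab : ⟪a, b⟫ = 0) :
    ContDiff ℝ 2 fun θ => radialFn K (circlePoint a b θ) := by
  have h1 : ContDiff ℝ 2 (circlePoint a b) := by
    unfold circlePoint
    fun_prop
  have h2 := (hsm.of_le (m := 2) (WithTop.coe_le_coe.2 le_top)).comp_contDiff h1
    (fun θ (h : circlePoint a b θ = 0) => by
      simpa [h] using (norm_circlePoint ha hb hab θ).symm)
  simpa [Function.comp_def, norm_circlePoint ha hb hab] using h2

/-- The distance from the axis to the boundary point in direction `θ` increases up to the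
equator. -/
theorem monotoneOn_sin_mul_radialFn {n : ℕ} {u₀ e : E n} {K : Set (E n)} (hK : IsConvexBody K)
    (hc : IsCentered K) (hrev : IsRevolutionBody u₀ K) (hu₀ : ‖u₀‖ = 1) (he : ‖e‖ = 1)
    (hue : ⟪u₀, e⟫ = 0) :
    MonotoneOn (fun θ => Real.sin θ * radialFn K (circlePoint u₀ e θ))
      (Set.Icc 0 (Real.pi / 2)) := by
  intro θ₁ h₁ θ₂ h₂ h
  have h0 := hK.zero_mem hc
  rcases h.eq_or_lt with rfl | hlt
  · exact le_rfl
  have hu₁ := norm_circlePoint hu₀ he hue θ₁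
  have hu₂ := norm_circlePoint hu₀ he hue θ₂
  obtain ⟨hρ, hmem⟩ := radialFn_mem hK.1 h0 hu₁
  set ρ := radialFn K (circlePoint u₀ e θ₁)
  have hs₂ : 0 < Real.sin θ₂ :=
    Real.sin_pos_of_pos_of_lt_pi (h₁.1.trans_lt hlt) (by linarith [h₂.2, Real.pi_pos])
  have hs₁ : 0 ≤ Real.sin θ₁ :=
    Real.sin_nonneg_of_nonneg_of_le_pi h₁.1 (by linarith [h₁.2, Real.pi_pos])
  have hc₁ : 0 ≤ Real.cos θ₁ := Real.cos_nonneg_of_mem_Icc ⟨by linarith [h₁.1, Real.pi_pos], h₁.2⟩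
  have hc₂ : 0 ≤ Real.cos θ₂ := Real.cos_nonneg_of_mem_Icc ⟨by linarith [h₂.1, Real.pi_pos], h₂.2⟩
  have hd : Real.cos θ₂ * Real.sin θ₁ ≤ Real.cos θ₁ * Real.sin θ₂ := by
    have := Real.sin_nonneg_of_nonneg_of_le_pi (sub_nonneg.2 h)
      (by linarith [h₂.2, Real.pi_pos, h₁.1])
    rw [Real.sin_sub] at this
    linarith
  have hmem' : (-(ρ * Real.cos θ₁)) • u₀ + (ρ * Real.sin θ₁) • e ∈ K := by
    let f := (ℝ ∙ u₀).reflection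
    have hf : f u₀ = u₀ :=
      Submodule.reflection_mem_subspace_eq_self (Submodule.mem_span_singleton_self u₀)
    have hfe : f e = -e := Submodule.reflection_mem_subspace_orthogonalComplement_eq_neg
      (Submodule.mem_orthogonal_singleton_iff_inner_right.2 hue)
    have := (hc _).1 ((hrev.mem_iff hf _).2 hmem)
    simpa [circlePoint, hf, hfe, mul_smul, smul_add, add_comm] using this
  have hmem'' : (ρ * Real.cos θ₁) • u₀ + (ρ * Real.sin θ₁) • e ∈ K := by
    simpa [circlePoint, mul_smul, smul_add] using hmem
  suffices hk : (ρ * Real.sin θ₁ / Real.sin θ₂) • circlePoint u₀ e θ₂ ∈ K by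
    have := le_radialFn hK.1 hu₂ (by positivity) hk
    rw [div_le_iff₀ hs₂] at this
    simp only
    linarith
  rcases hc₁.eq_or_lt with hc₁ | hc₁
  · have hz : Real.cos θ₂ * Real.sin θ₁ = 0 := by
      rw [← hc₁, zero_mul] at hd
      exact le_antisymm hd (by positivity)
    convert hmem'' using 1
    rw [circlePoint, smul_add, smul_smul, smul_smul, ← hc₁, div_mul_cancel₀ _ hs₂.ne',
      show ρ * Real.sin θ₁ / Real.sin θ₂ * Real.cos θ₂
        = ρ * (Real.cos θ₂ * Real.sin θ₁) / Real.sin θ₂ by ring, hz]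
    simp
  · set b := Real.cos θ₂ * Real.sin θ₁ / (Real.cos θ₁ * Real.sin θ₂) with hb
    have hb0 : 0 ≤ b := by positivity
    have hb1 : b ≤ 1 := div_le_one_of_le₀ hd (by positivity)
    have := hK.2.1 hmem'' hmem' (show 0 ≤ (1 + b) / 2 by linarith)
      (show 0 ≤ (1 - b) / 2 by linarith) (by ring)
    convert this using 1
    rw [circlePoint]
    have hbρ : ρ * Real.sin θ₁ / Real.sin θ₂ * Real.cos θ₂ = b * (ρ * Real.cos θ₁) := by
      rw [hb]; field_simp
    rw [smul_add, smul_smul, smul_smul, hbρ, div_mul_cancel₀ _ hs₂.ne']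
    module

/-- A `C²` function of the angle, symmetric about the equator, whose product with `sin` increases
up to the equator, is a Radon-type average of a nonnegative continuous function. -/
theorem exists_integral_representation {f : ℝ → ℝ} (hf : ContDiff ℝ 2 f)
    (hsymm : ∀ θ, f (Real.pi - θ) = f θ)
    (hmono : MonotoneOn (fun θ => Real.sin θ * f θ) (Set.Icc 0 (Real.pi / 2))) :
    ∃ h : ℝ → ℝ, Continuous h ∧ (∀ z, 0 ≤ h z) ∧
      ∀ θ ∈ Set.Icc 0 (Real.pi / 2), f θ = ∫ t in (0 : ℝ)..1, h (Real.sin θ ^ 2 * t ^ 2) := by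
  set X : ℝ → ℝ := fun θ => Real.sin θ * f θ with hX
  have hXc : ContDiff ℝ (1 + 1) X := by
    rw [one_add_one_eq_two]
    exact Real.contDiff_sin.mul hf
  have hXd : Differentiable ℝ X := hXc.differentiable (by simp)
  have hY : ContDiff ℝ 1 (deriv X) := (contDiff_succ_iff_deriv.1 hXc).2.2
  have hYpi : deriv X (Real.pi / 2) = 0 := by
    have h1 : (fun θ => X (Real.pi - θ)) = X := by
      ext θ; simp [hX, hsymm]
    have h2 := deriv_comp_const_sub X Real.pi (Real.pi / 2)
    rw [h1, show Real.pi - Real.pi / 2 = Real.pi / 2 by ring] at h2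
    linarith
  have hYnn : ∀ θ ∈ Set.Ioo 0 (Real.pi / 2), 0 ≤ deriv X θ := by
    intro θ hθ
    rw [← derivWithin_of_mem_nhds (Icc_mem_nhds hθ.1 hθ.2)]
    exact hmono.derivWithin_nonneg
  have hcos : ∀ θ ∈ Set.Icc 0 (Real.pi / 2), dslope Real.cos (Real.pi / 2) θ ≠ 0 := by
    intro θ hθ
    rcases hθ.2.eq_or_lt with rfl | hlt
    · simp
    · rw [dslope_of_ne _ hlt.ne, slope_def_field, Real.cos_pi_div_two, sub_zero]
      have : 0 < Real.cos θ := Real.cos_pos_of_mem_Ioo ⟨by linarith [hθ.1, Real.pi_pos], hlt⟩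
      exact div_ne_zero this.ne' (by linarith)
  have hdc : ∀ {g : ℝ → ℝ}, ContDiff ℝ 1 g → Continuous (dslope g (Real.pi / 2)) := by
    intro g hg
    have hgd := hg.differentiable (by simp)
    rw [← continuousOn_univ, continuousOn_dslope Filter.univ_mem]
    exact ⟨hgd.continuous.continuousOn, hgd _⟩
  set H : ℝ → ℝ := fun θ => dslope (deriv X) (Real.pi / 2) θ / dslope Real.cos (Real.pi / 2) θ
  have hHc : ContinuousOn H (Set.Icc 0 (Real.pi / 2)) :=
    (hdc hY).continuousOn.div (hdc Real.contDiff_cos).continuousOn hcos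
  have hHcos : ∀ θ ∈ Set.Icc 0 (Real.pi / 2), H θ * Real.cos θ = deriv X θ := by
    intro θ hθ
    rcases hθ.2.eq_or_lt with rfl | hlt
    · simp [hYpi]
    · have h1 := hcos θ hθ
      simp only [H]
      rw [dslope_of_ne _ hlt.ne, slope_def_field, Real.cos_pi_div_two] at h1
      rw [dslope_of_ne _ hlt.ne, dslope_of_ne _ hlt.ne, slope_def_field, slope_def_field, hYpi,
        Real.cos_pi_div_two]
      have h2 : θ - Real.pi / 2 ≠ 0 := by linarith
      rw [sub_zero] at h1 ⊢
      rw [sub_zero]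
      have h3 : Real.cos θ ≠ 0 := fun h => h1 (by simp [h])
      rw [div_div_div_cancel_right₀ h2, div_mul_cancel₀ _ h3]
  have hHnn : ∀ θ ∈ Set.Icc 0 (Real.pi / 2), 0 ≤ H θ := by
    have hlt : (0 : ℝ) < Real.pi / 2 := by positivity
    intro θ hθ
    rw [← closure_Ioo hlt.ne] at hθ hHc
    refine le_on_closure (f := fun _ => (0 : ℝ)) ?_ continuousOn_const hHc hθ
    intro θ hθ
    have h1 := hHcos θ ⟨hθ.1.le, hθ.2.le⟩
    have h2 : 0 < Real.cos θ := Real.cos_pos_of_mem_Ioo ⟨by linarith [hθ.1], hθ.2⟩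
    have h3 := hYnn θ hθ
    rw [← h1] at h3
    exact nonneg_of_mul_nonneg_left h3 h2
  have hmem : ∀ z : ℝ, Real.arcsin √z ∈ Set.Icc 0 (Real.pi / 2) := fun z =>
    ⟨Real.arcsin_nonneg.2 (Real.sqrt_nonneg z), Real.arcsin_le_pi_div_two _⟩
  have hh : Continuous fun z => H (Real.arcsin √z) :=
    hHc.comp_continuous (Real.continuous_arcsin.comp Real.continuous_sqrt) hmem
  refine ⟨fun z => H (Real.arcsin √z), hh, fun z => hHnn _ (hmem z), fun θ hθ => ?_⟩
  have harc : ∀ β ∈ Set.Icc 0 (Real.pi / 2), Real.arcsin √(Real.sin β ^ 2) = β := by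
    intro β hβ
    rw [Real.sqrt_sq (Real.sin_nonneg_of_nonneg_of_le_pi hβ.1 (by linarith [hβ.2, Real.pi_pos])),
      Real.arcsin_sin (by linarith [hβ.1, Real.pi_pos]) hβ.2]
  rcases hθ.1.eq_or_lt with rfl | hpos
  · have h1 := hHcos 0 hθ
    have h2 : deriv X 0 = f 0 := by
      have := (Real.hasDerivAt_sin 0).mul ((hf.differentiable (by simp)) 0).hasDerivAt
      simpa [hX, Pi.mul_def] using this.deriv
    simp only [Real.cos_zero, mul_one, h2] at h1
    simp [h1]
  · have hs : 0 < Real.sin θ :=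
      Real.sin_pos_of_pos_of_lt_pi hpos (by linarith [hθ.2, Real.pi_pos])
    apply mul_left_cancel₀ hs.ne'
    have h1 : ∫ β in (0 : ℝ)..θ, deriv X β = Real.sin θ * f θ := by
      rw [intervalIntegral.integral_deriv_eq_sub (fun β _ => hXd β)
        (hY.continuous.intervalIntegrable _ _)]
      simp [hX]
    have hg : Continuous fun r : ℝ => H (Real.arcsin √(r ^ 2)) := hh.comp (continuous_pow 2)
    have h2 : ∫ β in (0 : ℝ)..θ, ((fun r => H (Real.arcsin √(r ^ 2))) ∘ Real.sin) β * Real.cos β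
        = ∫ β in (0 : ℝ)..θ, deriv X β := by
      refine intervalIntegral.integral_congr fun β hβ => ?_
      rw [Set.uIcc_of_le hpos.le] at hβ
      have hβ' : β ∈ Set.Icc 0 (Real.pi / 2) := ⟨hβ.1, hβ.2.trans hθ.2⟩
      simp only [Function.comp_apply, harc β hβ', hHcos β hβ']
    rw [intervalIntegral.integral_comp_mul_deriv (fun β _ => Real.hasDerivAt_sin β)
      Real.continuous_cos.continuousOn  hg, Real.sin_zero, h1] at h2
    rw [← h2, ← smul_eq_mul (a := Real.sin θ)]
    simp_rw [← mul_pow]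
    rw [intervalIntegral.smul_integral_comp_mul_left (fun r => H (Real.arcsin √(r ^ 2)))]
    simp

theorem exists_orthogonal_unit {d : ℕ} (hd : 1 ≤ d) (u : E (d + 1)) :
    ∃ e : E (d + 1), ‖e‖ = 1 ∧ ⟪u, e⟫ = 0 := by
  have h1 : (ℝ ∙ u)ᗮ ≠ ⊥ := by
    intro h
    have h2 := Submodule.finrank_add_finrank_orthogonal (ℝ ∙ u)
    have h3 : Module.finrank ℝ (ℝ ∙ u) ≤ 1 := by
      simpa using finrank_span_le_card (R := ℝ) ({u} : Set (E (d + 1)))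
    rw [h, finrank_bot, finrank_euclideanSpace_fin] at h2
    lia
  have := (Submodule.nontrivial_iff_ne_bot (p := (ℝ ∙ u)ᗮ)).2 h1
  obtain ⟨e, he⟩ := exists_norm_eq (ℝ ∙ u)ᗮ zero_le_one
  exact ⟨e, he, Submodule.mem_orthogonal_singleton_iff_inner_right.1 e.2⟩

theorem exists_radialFn_eq_integral {d : ℕ} (hd : 1 ≤ d) {u₀ : E (d + 1)} {K : Set (E (d + 1))}
    (hu₀ : ‖u₀‖ = 1) (hK : IsConvexBody K) (hc : IsCentered K) (hrev : IsRevolutionBody u₀ K)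
    (hsm : SmoothOnSphere (radialFn K)) :
    ∃ h : ℝ → ℝ, Continuous h ∧ (∀ z, 0 ≤ h z) ∧ ∀ u : E (d + 1), ‖u‖ = 1 →
      radialFn K u = ∫ t in (0 : ℝ)..1, h ((1 - ⟪u, u₀⟫ ^ 2) * t ^ 2) := by
  obtain ⟨e, he, hue⟩ := exists_orthogonal_unit hd u₀
  have hn := norm_circlePoint hu₀ he hue
  have hi := inner_circlePoint (b := e) hu₀ hue
  have hsymm : ∀ θ,
      radialFn K (circlePoint u₀ e (Real.pi - θ)) = radialFn K (circlePoint u₀ e θ) := by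
    intro θ
    rw [← radialFn_neg hc]
    refine hrev.radialFn_eq (by rw [norm_neg, hn, hn]) ?_
    rw [inner_neg_left, hi, hi, Real.cos_pi_sub, neg_neg]
  obtain ⟨h, hh, hh0, hrep⟩ := exists_integral_representation
    (contDiff_radialFn_circlePoint hsm hu₀ he hue) hsymm
    (monotoneOn_sin_mul_radialFn hK hc hrev hu₀ he hue)
  refine ⟨h, hh, hh0, fun u hu => ?_⟩
  wlog hpos : 0 ≤ ⟪u, u₀⟫ generalizing u
  · have := this (-u) (by simpa using hu) (by rw [inner_neg_left]; linarith)
    rwa [radialFn_neg hc, inner_neg_left, neg_sq] at this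
  have hle : ⟪u, u₀⟫ ≤ 1 := by
    have := real_inner_le_norm u u₀
    rwa [hu, hu₀, mul_one] at this
  have hcos := Real.cos_arccos (by linarith) hle
  have := hrep (Real.arccos ⟪u, u₀⟫) ⟨Real.arccos_nonneg _, Real.arccos_le_pi_div_two.2 hpos⟩
  rw [Real.sin_sq, hcos] at this
  rw [← this]
  exact hrev.radialFn_eq (by rw [hu, hn]) (by rw [hi, hcos])

theorem exists_isometry_range_eq_hyperplane {d : ℕ} {u : E (d + 1)} (hu : ‖u‖ = 1) :
    ∃ ι : E d →ₗᵢ[ℝ] E (d + 1), Set.range ι = hyperplane u := by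
  have : Fact (Module.finrank ℝ (E (d + 1)) = d + 1) := ⟨finrank_euclideanSpace_fin⟩
  have hu0 : u ≠ 0 := by rintro rfl; simp at hu
  let b := OrthonormalBasis.fromOrthogonalSpanSingleton (𝕜 := ℝ) d hu0
  refine ⟨(ℝ ∙ u)ᗮ.subtypeₗᵢ.comp b.repr.symm.toLinearIsometry, ?_⟩
  ext x
  simp only [Set.mem_range, hyperplane]
  constructor
  · rintro ⟨y, rfl⟩
    exact Submodule.mem_orthogonal_singleton_iff_inner_left.1 (b.repr.symm y).2
  · intro hx
    exact ⟨b.repr ⟨x, Submodule.mem_orthogonal_singleton_iff_inner_left.2 hx⟩, by simp⟩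

theorem inner_isometry_eq_zero {d : ℕ} {u : E (d + 1)} {ι : E d →ₗᵢ[ℝ] E (d + 1)}
    (hι : Set.range ι = hyperplane u) (y : E d) : ⟪ι y, u⟫ = 0 := by
  have : ι y ∈ hyperplane u := hι ▸ Set.mem_range_self y
  exact this

/-- Orthogonal decomposition of a unit vector along a hyperplane. -/
theorem exists_eq_isometry_add_smul {d : ℕ} {u : E (d + 1)} (hu : ‖u‖ = 1)
    {ι : E d →ₗᵢ[ℝ] E (d + 1)} (hι : Set.range ι = hyperplane u) {x : E (d + 1)} (hx : ‖x‖ = 1) :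
    ∃ w : E d, x = ι w + ⟪x, u⟫ • u ∧ ‖w‖ ^ 2 = 1 - ⟪x, u⟫ ^ 2 := by
  have h1 : x - ⟪x, u⟫ • u ∈ Set.range ι := by
    rw [hι]
    change ⟪x - ⟪x, u⟫ • u, u⟫ = 0
    simp [inner_sub_left, inner_smul_left, hu]
  obtain ⟨w, hw⟩ := h1
  refine ⟨w, by rw [hw]; abel, ?_⟩
  rw [← ι.norm_map, hw, norm_sub_sq_real, inner_smul_right, norm_smul, hx, hu]
  simp
  ring

theorem radon_eq {d : ℕ} (hd : 1 ≤ d) {u : E (d + 1)} {ι : E d →ₗᵢ[ℝ] E (d + 1)}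
    (hι : Set.range ι = hyperplane u) (g : E (d + 1) → ℝ) :
    radon (d + 1) g u = ∫ v in sphere (0 : E d) 1, g (ι v) ∂μH[(d : ℝ) - 1] := by
  have he : MeasurableEmbedding ι := ι.isometry.isClosedEmbedding.measurableEmbedding
  have hd' : (1 : ℝ) ≤ d := by exact_mod_cast hd
  have hs : ι ⁻¹' sphere (0 : E (d + 1)) 1 = sphere (0 : E d) 1 := by ext; simp
  rw [radon, show ((d + 1 : ℕ) : ℝ) - 2 = d - 1 by push_cast; ring, ← hι,
    ← Measure.restrict_restrict isClosed_sphere.measurableSet,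
    ← ι.isometry.map_hausdorffMeasure (Or.inl (by linarith)), he.setIntegral_map, hs]

theorem hausdorffMeasure_inter_hyperplane {d : ℕ} {u : E (d + 1)} {ι : E d →ₗᵢ[ℝ] E (d + 1)}
    (hι : Set.range ι = hyperplane u) (M : Set (E (d + 1))) :
    μH[((d + 1 : ℕ) : ℝ) - 1] (M ∩ hyperplane u) = μH[(d : ℝ)] (ι ⁻¹' M) := by
  rw [show ((d + 1 : ℕ) : ℝ) - 1 = d by push_cast; ring, ← hι, ← Set.image_preimage_eq_inter_range,
    ι.isometry.hausdorffMeasure_image (Or.inl (by positivity))]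

theorem isInvariantSphereMeasure_hausdorffMeasure (d : ℕ) (s : ℝ) :
    IsInvariantSphereMeasure ((μH[s] : Measure (E d)).restrict (sphere 0 1)) where
  norm_eq_one := by
    filter_upwards [ae_restrict_mem isClosed_sphere.measurableSet] with v hv
    simpa using hv
  map_eq f := by
    have hs : f ⁻¹' sphere (0 : E d) 1 = sphere (0 : E d) 1 := by ext; simp
    conv_lhs => rw [← hs]
    rw [← Measure.restrict_map f.continuous.measurable isClosed_sphere.measurableSet]
    congr 1
    exact f.toIsometryEquiv.map_hausdorffMeasure s

instance isAddHaarMeasure_hausdorffMeasure_euclideanSpace (d : ℕ) :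
    (μH[(d : ℝ)] : Measure (E d)).IsAddHaarMeasure := by
  simpa using isAddHaarMeasure_hausdorffMeasure (E := E d)

theorem hausdorffMeasure_hemisphere_lt_top {d : ℕ} {v : E (d + 1)} (hv : ‖v‖ = 1) :
    μH[(d : ℝ)] (sphere (0 : E (d + 1)) 1 ∩ {x | ⟪x, v⟫ ≤ 0}) < ⊤ := by
  obtain ⟨ι, hι⟩ := exists_isometry_range_eq_hyperplane hv
  have hsm : ContDiff ℝ 1 fun y : E d => stereoInvFunAux v (ι y) :=
    contDiff_stereoInvFunAux.comp ι.toContinuousLinearMap.contDiff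
  obtain ⟨C, hC⟩ : ∃ C, LipschitzOnWith C (fun y : E d => stereoInvFunAux v (ι y))
      (closedBall 0 2) :=
    hsm.locallyLipschitz.locallyLipschitzOn.exists_lipschitzOnWith_of_compact
      (isCompact_closedBall 0 2)
  have hsub : sphere (0 : E (d + 1)) 1 ∩ {x | ⟪x, v⟫ ≤ 0}
      ⊆ (fun y : E d => stereoInvFunAux v (ι y)) '' closedBall 0 2 := by
    rintro x ⟨hx, hxv⟩
    rw [mem_sphere_zero_iff_norm] at hx
    obtain ⟨w, hw, hwn⟩ := exists_eq_isometry_add_smul hv hι hx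
    set c := ⟪x, v⟫
    have hc0 : c ≤ 0 := hxv
    have hc : 0 < 1 - c := by linarith
    have hy : ‖(2 / (1 - c)) • w‖ ^ 2 = 4 * (1 + c) / (1 - c) := by
      rw [norm_smul, mul_pow, hwn, Real.norm_eq_abs, sq_abs]
      field_simp
      ring
    refine ⟨(2 / (1 - c)) • w, ?_, ?_⟩
    · rw [mem_closedBall_zero_iff]
      refine le_of_sq_le_sq ?_ zero_le_two
      rw [hy, div_le_iff₀ hc]
      linarith
    · simp only [stereoInvFunAux_apply, ι.norm_map, hy]
      have h1 : 4 * (1 + c) / (1 - c) + 4 = 8 / (1 - c) := by field_simp; ring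
      have h2 : 4 * (1 + c) / (1 - c) - 4 = 8 * c / (1 - c) := by field_simp; ring
      rw [h1, h2, map_smul]
      conv_rhs => rw [hw]
      rw [smul_add, smul_smul, smul_smul, smul_smul]
      congr 2
      · field_simp; norm_num
      · field_simp
  refine (measure_mono hsub).trans_lt ((hC.hausdorffMeasure_image_le (by positivity)).trans_lt ?_)
  exact ENNReal.mul_lt_top (by simp) measure_closedBall_lt_top

theorem hausdorffMeasure_sphere_lt_top (d : ℕ) :
    μH[(d : ℝ)] (sphere (0 : E (d + 1)) 1) < ⊤ := by
  obtain ⟨v, hv⟩ := exists_norm_eq (E (d + 1)) zero_le_one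
  have hsub : sphere (0 : E (d + 1)) 1 ⊆ (sphere (0 : E (d + 1)) 1 ∩ {x | ⟪x, v⟫ ≤ 0})
      ∪ (sphere (0 : E (d + 1)) 1 ∩ {x | ⟪x, -v⟫ ≤ 0}) := by
    intro x hx
    rcases le_total ⟪x, v⟫ 0 with h | h
    · exact Or.inl ⟨hx, h⟩
    · exact Or.inr ⟨hx, by simpa using h⟩
  exact (measure_mono hsub).trans_lt (measure_union_lt_top (hausdorffMeasure_hemisphere_lt_top hv)
    (hausdorffMeasure_hemisphere_lt_top (by simpa using hv)))

theorem hausdorffMeasure_sphere_pos (d : ℕ) :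
    0 < μH[(d : ℝ)] (sphere (0 : E (d + 1)) 1) := by
  obtain ⟨v, hv⟩ := exists_norm_eq (E (d + 1)) zero_le_one
  obtain ⟨ι, hι⟩ := exists_isometry_range_eq_hyperplane hv
  let P := ι.toContinuousLinearMap.adjoint
  have hP : LipschitzWith 1 P := by
    refine P.lipschitz.weaken ?_
    rw [← NNReal.coe_le_coe, coe_nnnorm, NNReal.coe_one, LinearIsometryEquiv.norm_map]
    exact ι.norm_toContinuousLinearMap_le
  have hPι : ∀ y, P (ι y) = y := fun y => ext_inner_right ℝ fun z => by
    rw [ContinuousLinearMap.adjoint_inner_left]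
    exact ι.inner_map_map y z
  have hPv : P v = 0 := ext_inner_right ℝ fun z => by
    rw [ContinuousLinearMap.adjoint_inner_left, real_inner_comm, inner_zero_left]
    exact inner_isometry_eq_zero hι z
  have hsub : closedBall (0 : E d) 1 ⊆ P '' sphere (0 : E (d + 1)) 1 := by
    intro y hy
    rw [mem_closedBall_zero_iff] at hy
    refine ⟨ι y + √(1 - ‖y‖ ^ 2) • v, ?_, by simp [hPι, hPv]⟩
    have h1 : 0 ≤ 1 - ‖y‖ ^ 2 := sub_nonneg.2 (pow_le_one₀ (norm_nonneg y) hy)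
    rw [mem_sphere_zero_iff_norm]
    refine (pow_eq_one_iff_of_nonneg (norm_nonneg _) two_ne_zero).1 ?_
    rw [norm_add_sq_real, inner_smul_right, inner_isometry_eq_zero hι, norm_smul, hv, ι.norm_map,
      mul_one, Real.norm_eq_abs, sq_abs, Real.sq_sqrt h1]
    ring
  have h1 := hP.hausdorffMeasure_image_le (d := d) (by positivity) (sphere (0 : E (d + 1)) 1)
  rw [ENNReal.coe_one, ENNReal.one_rpow, one_mul] at h1
  exact ((measure_closedBall_pos μH[(d : ℝ)] (0 : E d) one_pos).trans_le
    (measure_mono hsub)).trans_le h1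

theorem volumeIoiPow_setOf_le (n : ℕ) {a : ℝ} (ha : 0 ≤ a) :
    Measure.volumeIoiPow n {r | (r : ℝ) ≤ a} = ENNReal.ofReal (a ^ (n + 1) / (n + 1)) := by
  have himg : Subtype.val '' {r : Set.Ioi (0 : ℝ) | (r : ℝ) ≤ a} = Set.Ioc 0 a := by
    ext x
    simp [Set.mem_Ioc, and_comm]
  rw [Measure.volumeIoiPow,
    withDensity_apply _ (measurableSet_le measurable_subtype_coe measurable_const),
    setLIntegral_subtype measurableSet_Ioi _ fun a : ℝ ↦ .ofReal (a ^ n), himg,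
    ← ofReal_integral_eq_lintegral_ofReal
      (intervalIntegral.intervalIntegrable_pow (μ := volume) (a := 0) (b := a) n).1,
    ← intervalIntegral.integral_of_le ha]
  · simp
  · filter_upwards [ae_restrict_mem measurableSet_Ioc] with y hy
    exact pow_nonneg hy.1.le _

/-- The measure of a star-shaped set in polar coordinates. -/
theorem measure_setOf_norm_le {d : ℕ} (hd : 1 ≤ d) (μ : Measure (E d)) [μ.IsAddHaarMeasure]
    {R : E d → ℝ} (hR : Continuous R) (hR0 : ∀ v, 0 ≤ R v) :
    μ {y | ‖y‖ ≤ R (‖y‖⁻¹ • y)} = ENNReal.ofReal (∫ v, R v ^ d / d ∂μ.toSphere.map (↑)) := by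
  have : NeZero d := ⟨by omega⟩
  obtain ⟨m, rfl⟩ : ∃ m, d = m + 1 := ⟨d - 1, by omega⟩
  have hRm : MeasurableSet {y : E (m + 1) | ‖y‖ ≤ R (‖y‖⁻¹ • y)} :=
    measurableSet_le measurable_norm
      (hR.measurable.comp ((measurable_norm.inv).smul measurable_id))
  have h0 : MeasurableSet ({0}ᶜ : Set (E (m + 1))) := (measurableSet_singleton _).compl
  have hintegral : Integrable (fun v : sphere (0 : E (m + 1)) 1 => R v ^ (m + 1) / ((m + 1 : ℕ) : ℝ))
      μ.toSphere := by
    refine Continuous.integrable_of_hasCompactSupport (by fun_prop) ?_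
    exact HasCompactSupport.of_compactSpace _
  rw [MeasurableEmbedding.integral_map (MeasurableEmbedding.subtype_coe
      isClosed_sphere.measurableSet),
    ofReal_integral_eq_lintegral_ofReal hintegral (Filter.Eventually.of_forall fun v => by
      have := hR0 v; positivity)]
  have h1 : μ {y | ‖y‖ ≤ R (‖y‖⁻¹ • y)} = μ.comap ((↑) : ({0}ᶜ : Set (E (m + 1))) → E (m + 1))
      ((↑) ⁻¹' {y | ‖y‖ ≤ R (‖y‖⁻¹ • y)}) := by
    rw [comap_subtype_coe_apply h0, Subtype.image_preimage_coe, Set.inter_comm,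
      ← Set.sdiff_eq, measure_sdiff_null (measure_singleton _)]
  have h2 : ((↑) : ({0}ᶜ : Set (E (m + 1))) → E (m + 1)) ⁻¹' {y | ‖y‖ ≤ R (‖y‖⁻¹ • y)} =
      homeomorphUnitSphereProd (E (m + 1)) ⁻¹' {p | (p.2 : ℝ) ≤ R p.1} := by
    ext y
    simp
  have hm : MeasurableSet {p : sphere (0 : E (m + 1)) 1 × Set.Ioi (0 : ℝ) | (p.2 : ℝ) ≤ R p.1} :=
    (isClosed_le (by fun_prop) (by fun_prop)).measurableSet
  rw [h1, h2, μ.measurePreserving_homeomorphUnitSphereProd.measure_preimage hm.nullMeasurableSet,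
    Measure.prod_apply hm]
  refine lintegral_congr fun v => ?_
  have := volumeIoiPow_setOf_le m (hR0 v)
  simp only [finrank_euclideanSpace_fin, Nat.add_sub_cancel, Nat.cast_add, Nat.cast_one]
  exact this

theorem isInvariantSphereMeasure_toSphere {d : ℕ} (μ : Measure (E d))
    (hμ : ∀ f : E d ≃ₗᵢ[ℝ] E d, μ.map f = μ) :
    IsInvariantSphereMeasure (μ.toSphere.map ((↑) : sphere (0 : E d) 1 → E d)) where
  norm_eq_one := by
    have he := MeasurableEmbedding.subtype_coe
      (isClosed_sphere (x := (0 : E d)) (ε := 1)).measurableSet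
    rw [he.ae_map_iff]
    exact Filter.Eventually.of_forall fun v => norm_eq_of_mem_sphere v
  map_eq f := by
    have he := MeasurableEmbedding.subtype_coe
      (isClosed_sphere (x := (0 : E d)) (ε := 1)).measurableSet
    ext s hs
    have hfs := f.continuous.measurable hs
    rw [Measure.map_apply f.continuous.measurable hs, he.map_apply, he.map_apply,
      Measure.toSphere_apply' _ (he.measurable hfs), Measure.toSphere_apply' _ (he.measurable hs)]
    congr 1
    have hf : MeasurableEmbedding f := f.toHomeomorph.measurableEmbedding
    conv_rhs => rw [← hμ f, hf.map_apply]
    congr 1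
    ext x
    simp only [Subtype.image_preimage_coe, Set.mem_preimage, Set.mem_smul]
    constructor
    · rintro ⟨r, hr, v, ⟨hv, hv'⟩, rfl⟩
      exact ⟨r, hr, f v, ⟨by simpa using hv, hv'⟩, by simp⟩
    · rintro ⟨r, hr, v, ⟨hv, hv'⟩, h⟩
      exact ⟨r, hr, f.symm v, ⟨by simpa using hv, by simpa using hv'⟩, by
        rw [← map_smul, h]; exact f.symm_apply_apply x⟩

/-- The set with a prescribed radial function `r`. -/
def starSet {n : ℕ} (r : E n → ℝ) : Set (E n) := {x | ‖x‖ ≤ r (‖x‖⁻¹ • x)}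

theorem smul_mem_starSet {n : ℕ} {r : E n → ℝ} (hr0 : ∀ v, 0 ≤ r v) {v : E n} (hv : ‖v‖ = 1)
    {c : ℝ} (hc : 0 ≤ c) : c • v ∈ starSet r ↔ c ≤ r v := by
  rcases hc.eq_or_lt with rfl | hc
  · simp [starSet, hr0]
  · simp [starSet, norm_smul, hv, abs_of_pos hc, smul_smul, hc.ne']

theorem radialFn_starSet {n : ℕ} {r : E n → ℝ} (hr0 : ∀ v, 0 ≤ r v) {v : E n} (hv : ‖v‖ = 1) :
    radialFn (starSet r) v = r v := by
  have : {c : ℝ | 0 ≤ c ∧ c • v ∈ starSet r} = Set.Icc 0 (r v) := by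
    ext c
    exact and_congr_right fun hc => smul_mem_starSet hr0 hv hc
  rw [radialFn, this, csSup_Icc (hr0 v)]

theorem exists_nonneg_smul_unit {F : Type*} [NormedAddCommGroup F] [NormedSpace ℝ F]
    [Nontrivial F] (x : F) : ∃ v : F, ‖v‖ = 1 ∧ ∃ c : ℝ, 0 ≤ c ∧ x = c • v := by
  obtain ⟨v, hv, hx⟩ := exists_smul_unit x
  exact ⟨v, hv, ‖x‖, norm_nonneg x, hx⟩

theorem starSet_eq_image {d : ℕ} {r : E (d + 1) → ℝ} (hr0 : ∀ v, 0 ≤ r v) :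
    starSet r = (fun p : E (d + 1) × ℝ => (p.2 * r p.1) • p.1) ''
      (sphere (0 : E (d + 1)) 1 ×ˢ Set.Icc 0 1) := by
  ext x
  constructor
  · intro hx
    obtain ⟨v, hv, c, hc, rfl⟩ := exists_nonneg_smul_unit x
    have hcr := (smul_mem_starSet hr0 hv hc).1 hx
    rcases (hr0 v).eq_or_lt with h | h
    · refine ⟨(v, 0), ⟨by simpa using hv, by simp⟩, ?_⟩
      simp [le_antisymm (h ▸ hcr) hc]
    · refine ⟨(v, c / r v), ⟨by simpa using hv, div_nonneg hc h.le, (div_le_one h).2 hcr⟩, ?_⟩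
      simp [h.ne']
  · rintro ⟨⟨v, t⟩, ⟨hv, ht0, ht1⟩, rfl⟩
    exact (smul_mem_starSet hr0 (by simpa using hv) (mul_nonneg ht0 (hr0 v))).2
      (mul_le_of_le_one_left (hr0 v) ht1)

theorem isStarBody_starSet {d : ℕ} {r : E (d + 1) → ℝ} (hr : Continuous r) (hr0 : ∀ v, 0 ≤ r v) :
    IsStarBody (starSet r) := by
  refine ⟨?_, by simp [starSet, hr0], starConvex_zero_iff.2 ?_, ?_⟩
  · rw [starSet_eq_image hr0]
    exact ((isCompact_sphere _ _).prod isCompact_Icc).image (by fun_prop)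
  · intro x hx a ha0 ha1
    obtain ⟨v, hv, c, hc, rfl⟩ := exists_nonneg_smul_unit x
    rw [smul_smul, smul_mem_starSet hr0 hv (mul_nonneg ha0 hc)]
    exact (mul_le_of_le_one_left hc ha1).trans ((smul_mem_starSet hr0 hv hc).1 hx)
  · exact hr.continuousOn.congr fun v hv => radialFn_starSet hr0 (by simpa using hv)

theorem preimage_starSet {d n : ℕ} (ι : E d →ₗᵢ[ℝ] E n) (r : E n → ℝ) :
    ι ⁻¹' starSet r = {y | ‖y‖ ≤ (r ∘ ι) (‖y‖⁻¹ • y)} := by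
  ext y
  simp [starSet]

theorem IsInvariantSphereMeasure.integral_smoothing_isometry {d : ℕ} {μ : Measure (E d)}
    [IsFiniteMeasure μ] (hμ : IsInvariantSphereMeasure μ) (i : Fin d) {κ : Measure ℝ}
    [IsFiniteMeasure κ] (hκ : ∀ᵐ y ∂κ, y ∈ Set.Icc (0 : ℝ) 1) (hκ1 : κ.real Set.univ = 1)
    (hmom : ∀ k : ℕ, (2 * k + 3 : ℝ) * ∫ y, y ^ (k + 1) ∂κ = (2 * k + d) * ∫ y, y ^ k ∂κ)
    {h : ℝ → ℝ} (hh : Continuous h) {u u₀ : E (d + 1)} (hu : ‖u‖ = 1) (hu₀ : ‖u₀‖ = 1)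
    {ι : E d →ₗᵢ[ℝ] E (d + 1)} (hι : Set.range ι = hyperplane u) :
    ∫ v, (∫ y, h (⟪ι v, u₀⟫ ^ 2 * y) ∂κ) ∂μ =
      μ.real Set.univ * ∫ t in (0:ℝ)..1, h ((1 - ⟪u, u₀⟫ ^ 2) * t ^ 2) := by
  obtain ⟨w, hw, hwn⟩ := exists_eq_isometry_add_smul hu hι hu₀
  have hin : ∀ v, ⟪ι v, u₀⟫ = ⟪v, w⟫ := fun v => by
    conv_lhs => rw [hw]
    rw [inner_add_right, inner_smul_right, inner_isometry_eq_zero hι, ι.inner_map_map, mul_zero,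
      add_zero]
  simp only [hin]
  rw [hμ.integral_smoothing i hκ hκ1 hmom hh w, hwn, real_inner_comm]

theorem isIntersectionBody_and_radon_of_revolution {d : ℕ} (hd : d = 2 ∨ d = 3)
    {u₀ : E (d + 1)} (hu₀ : ‖u₀‖ = 1) {K : Set (E (d + 1))} (hK : IsConvexBody K)
    (hc : IsCentered K) (hrev : IsRevolutionBody u₀ K) (hsm : SmoothOnSphere (radialFn K)) :
    (∃ M : Set (E (d + 1)), IsStarBody M ∧ IsIntersectionBodyOf K M) ∧
    (∃ g : E (d + 1) → ℝ, ContinuousOn g (sphere (0 : E (d + 1)) 1) ∧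
      (∀ v ∈ sphere (0 : E (d + 1)) 1, 0 ≤ g v) ∧
      (∀ u ∈ sphere (0 : E (d + 1)) 1, radialFn K u = radon (d + 1) g u)) := by
  have hd1 : 1 ≤ d := by omega
  have : NeZero d := ⟨by omega⟩
  obtain ⟨h, hh, hh0, hrep⟩ := exists_radialFn_eq_integral hd1 hu₀ hK hc hrev hsm
  obtain ⟨κ, _, hκ, hκ1, hmom⟩ := exists_smoothing_measure hd
  have hkc : Continuous fun x : E (d + 1) => ∫ y, h (⟪x, u₀⟫ ^ 2 * y) ∂κ :=
    (continuous_integral_mul hκ hh).comp (f := fun x : E (d + 1) => ⟪x, u₀⟫ ^ 2) (by fun_prop)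
  have hk0 : ∀ x : E (d + 1), 0 ≤ ∫ y, h (⟪x, u₀⟫ ^ 2 * y) ∂κ := fun x =>
    integral_nonneg fun y => hh0 _
  set k : E (d + 1) → ℝ := fun x => ∫ y, h (⟪x, u₀⟫ ^ 2 * y) ∂κ
  have hintegral : ∀ (μ : Measure (E d)) [IsFiniteMeasure μ], IsInvariantSphereMeasure μ →
      ∀ {u : E (d + 1)}, ‖u‖ = 1 → ∀ {ι : E d →ₗᵢ[ℝ] E (d + 1)}, Set.range ι = hyperplane u →
      ∫ v, k (ι v) ∂μ = μ.real Set.univ * radialFn K u := fun μ _ hμ u hu ι hι => by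
    rw [hrep u hu]
    exact hμ.integral_smoothing_isometry 0 hκ hκ1 hmom hh hu hu₀ hι
  constructor
  · set σ : Measure (E d) :=
      (μH[(d : ℝ)] : Measure (E d)).toSphere.map ((↑) : sphere (0 : E d) 1 → E d) with hσ
    have hσi : IsInvariantSphereMeasure σ := isInvariantSphereMeasure_toSphere _ fun f =>
      f.toIsometryEquiv.map_hausdorffMeasure _
    have hσ0 : σ.real Set.univ ≠ 0 := by
      have : Nontrivial (E d) := inferInstance
      rw [hσ, map_measureReal_apply measurable_subtype_coe .univ, Set.preimage_univ,
        measureReal_ne_zero_iff, Measure.measure_univ_ne_zero]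
      exact Measure.toSphere_ne_zero _
    have hσp : 0 < σ.real Set.univ := lt_of_le_of_ne measureReal_nonneg hσ0.symm
    set r : E (d + 1) → ℝ := fun x => (d / σ.real Set.univ * k x) ^ (d : ℝ)⁻¹ with hr
    have hr0 : ∀ x, 0 ≤ r x := fun x =>
      Real.rpow_nonneg (mul_nonneg (div_nonneg d.cast_nonneg hσp.le) (hk0 x)) _
    have hrc : Continuous r := (continuous_const.mul hkc).rpow_const fun x => Or.inr (by positivity)
    have hrd : ∀ x, r x ^ d / d = k x / σ.real Set.univ := fun x => by
      rw [hr]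
      dsimp only
      rw [Real.rpow_inv_natCast_pow (mul_nonneg (div_nonneg d.cast_nonneg hσp.le) (hk0 x))
        (NeZero.ne d)]
      rw [div_mul_eq_mul_div, div_div, mul_comm _ (d : ℝ), mul_div_mul_left _ _ (NeZero.ne _)]
    refine ⟨starSet r, isStarBody_starSet hrc hr0, fun u hu => ?_⟩
    rw [mem_sphere_zero_iff_norm] at hu
    obtain ⟨ι, hι⟩ := exists_isometry_range_eq_hyperplane hu
    rw [hausdorffMeasure_inter_hyperplane hι, preimage_starSet,
      measure_setOf_norm_le hd1 _ (hrc.comp ι.continuous) fun v => hr0 _]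
    simp only [Function.comp_apply, hrd]
    rw [integral_div, hintegral σ hσi hu hι, mul_div_cancel_left₀ _ hσ0, ENNReal.toReal_ofReal]
    exact Real.sSup_nonneg fun c hc => hc.1
  · set A : Measure (E d) := (μH[(d : ℝ) - 1] : Measure (E d)).restrict (sphere 0 1) with hA
    obtain ⟨hA0, hAt⟩ : A Set.univ ≠ 0 ∧ A Set.univ < ⊤ := by
      obtain ⟨m, rfl⟩ : ∃ m, d = m + 1 := ⟨d - 1, by omega⟩
      rw [hA, Measure.restrict_apply_univ, Nat.cast_succ, add_sub_cancel_right]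
      exact ⟨(hausdorffMeasure_sphere_pos m).ne', hausdorffMeasure_sphere_lt_top m⟩
    have : IsFiniteMeasure A := ⟨hAt⟩
    have hA1 : A.real Set.univ ≠ 0 := (ENNReal.toReal_pos hA0 hAt.ne).ne'
    refine ⟨fun v => k v / A.real Set.univ, (hkc.div_const _).continuousOn,
      fun v _ => div_nonneg (hk0 v) measureReal_nonneg, fun u hu => ?_⟩
    rw [mem_sphere_zero_iff_norm] at hu
    obtain ⟨ι, hι⟩ := exists_isometry_range_eq_hyperplane hu
    rw [radon_eq hd1 hι, integral_div,
      hintegral A (isInvariantSphereMeasure_hausdorffMeasure d _) hu hι, mul_div_cancel_left₀ _ hA1]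

/-- In dimension 3 or 4, a centered convex body of revolution with `C^∞` radial
function is the intersection body of some star body: `ρ_K = Rg` with `g ≥ 0`
continuous. -/
theorem smooth_revolution_body_is_intersection_body (n : ℕ) (hn : n = 3 ∨ n = 4)
    (u₀ : E n) (hu₀ : u₀ ∈ sphere (0 : E n) 1) (K : Set (E n))
    (hK : IsConvexBody K) (hc : IsCentered K)
    (hrev : IsRevolutionBody u₀ K)
    (hsm : SmoothOnSphere (radialFn K)) :
    (∃ M : Set (E n), IsStarBody M ∧ IsIntersectionBodyOf K M) ∧
    (∃ g : E n → ℝ, ContinuousOn g (sphere (0 : E n) 1) ∧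
      (∀ v ∈ sphere (0 : E n) 1, 0 ≤ g v) ∧
      (∀ u ∈ sphere (0 : E n) 1, radialFn K u = radon n g u)) := by
  rw [mem_sphere_zero_iff_norm] at hu₀
  rcases hn with rfl | rfl
  · exact isIntersectionBody_and_radon_of_revolution (Or.inl rfl) hu₀ hK hc hrev hsm
  · exact isIntersectionBody_and_radon_of_revolution (Or.inr rfl) hu₀ hK hc hrev hsm
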